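/- Let 0 < p₁ ≤ 1 and 0 < λ < 1, and let s > 0 satisfy 1/s > 1/(2(1−λ)). Then there exists a constant C > 0 such that for every N ∈ ℕ, sup_{n ∈ ℕ} n^{1/s} · a_n(id : ℓ_{p₁}^N → ℓ_∞^N) ≤ C · N^{1/s − 1/2}, where a_n denotes the n-th approximation number. -/

import Mathlib

open scoped ENNReal BigOperators

/-- The ℓ_p quasi-norm on ℝ^N, for `p : ℝ≥0∞` (with `p = ∞` giving the sup-norm). -/
noncomputable def pNorm (p : ℝ≥0∞) {N : ℕ} (x : Fin N → ℝ) : ℝ :=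
  if p = ∞ then ⨆ i, |x i| else (∑ i, |x i| ^ p.toReal) ^ (1 / p.toReal)

/-- The n-th Kolmogorov number of the identity map `id : ℓ_p^N → ℓ_q^N`. -/
noncomputable def kolmogorovNumber (p q : ℝ≥0∞) (N n : ℕ) : ℝ :=
  sInf { r : ℝ | ∃ V : Submodule ℝ (Fin N → ℝ), Module.finrank ℝ (↥V) < n ∧
    r = sSup { s : ℝ | ∃ x : Fin N → ℝ, pNorm p x ≤ 1 ∧
      s = sInf { t : ℝ | ∃ v ∈ V, t = pNorm q (x - v) } } }

/-- The n-th Gelfand number of the identity map `id : ℓ_p^N → ℓ_q^N`. -/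
noncomputable def gelfandNumber (p q : ℝ≥0∞) (N n : ℕ) : ℝ :=
  sInf { r : ℝ | ∃ M : Submodule ℝ (Fin N → ℝ), N - Module.finrank ℝ (↥M) < n ∧
    r = sSup { s : ℝ | ∃ x ∈ M, pNorm p x ≤ 1 ∧ s = pNorm q x } }

/-- The n-th approximation number of the identity map `id : ℓ_p^N → ℓ_q^N`. -/
noncomputable def approxNumber (p q : ℝ≥0∞) (N n : ℕ) : ℝ :=
  sInf { r : ℝ | ∃ L : (Fin N → ℝ) →ₗ[ℝ] (Fin N → ℝ),
    Module.finrank ℝ (↥(LinearMap.range L)) < n ∧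
    r = sSup { s : ℝ | ∃ x : Fin N → ℝ, pNorm p x ≤ 1 ∧ s = pNorm q (x - L x) } }

lemma sum_abs_le_one_of_pNorm_le_one {p : ℝ} (hp : 0 < p) (hp1 : p ≤ 1) {N : ℕ}
    {x : Fin N → ℝ} (hx : pNorm (ENNReal.ofReal p) x ≤ 1) : ∑ i, |x i| ≤ 1 := by
  have hnn : ∀ i, 0 ≤ |x i| ^ p := fun i => Real.rpow_nonneg (abs_nonneg _) _
  have hsum : ∑ i, |x i| ^ p ≤ 1 := by
    rw [pNorm, if_neg ENNReal.ofReal_ne_top, ENNReal.toReal_ofReal hp.le] at hx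
    by_contra! h
    exact absurd hx (not_le.mpr (Real.one_lt_rpow h (by positivity)))
  refine (Finset.sum_le_sum fun i _ => ?_).trans hsum
  have hi : |x i| ≤ 1 := by
    have h1 : |x i| ^ p ≤ 1 :=
      (Finset.single_le_sum (fun j _ => hnn j) (Finset.mem_univ i)).trans hsum
    by_contra! h
    exact absurd h1 (not_le.mpr (Real.one_lt_rpow h hp))
  rcases (abs_nonneg (x i)).eq_or_lt with h0 | h0
  · rw [← h0]
    exact Real.rpow_nonneg le_rfl _
  · simpa using Real.rpow_le_rpow_of_exponent_ge h0 hi hp1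

lemma approxNumber_top_le_of_linearMap {p : ℝ≥0∞} {N n : ℕ} {B : ℝ} (hB : 0 ≤ B)
    (L : (Fin N → ℝ) →ₗ[ℝ] (Fin N → ℝ)) (hL : Module.finrank ℝ (LinearMap.range L) < n)
    (h : ∀ x : Fin N → ℝ, pNorm p x ≤ 1 → ∀ i, |x i - L x i| ≤ B) :
    approxNumber p ∞ N n ≤ B := by
  rw [approxNumber]
  refine le_trans (csInf_le ⟨0, ?_⟩ ⟨L, hL, rfl⟩) (Real.sSup_le ?_ hB)
  · rintro r ⟨L', -, rfl⟩
    refine Real.sSup_nonneg ?_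
    rintro t ⟨x, -, rfl⟩
    simpa [pNorm] using Real.iSup_nonneg fun i => abs_nonneg ((x - L' x) i)
  · rintro t ⟨x, hx, rfl⟩
    simpa [pNorm] using Real.iSup_le (h x hx) hB

lemma approxNumber_top_le_of_matrix {p : ℝ} (hp : 0 < p) (hp1 : p ≤ 1) {N n : ℕ} {B : ℝ}
    (hB : 0 ≤ B) (M : Matrix (Fin N) (Fin N) ℝ) (hM : M.rank < n)
    (h : ∀ i j, |(1 - M) i j| ≤ B) :
    approxNumber (ENNReal.ofReal p) ∞ N n ≤ B := by
  refine approxNumber_top_le_of_linearMap hB M.mulVecLin hM fun x hx i => ?_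
  have hx1 := sum_abs_le_one_of_pNorm_le_one hp hp1 hx
  have hsub : x i - M.mulVecLin x i = ∑ j, (1 - M) i j * x j := by
    have : x - M.mulVecLin x = (1 - M).mulVec x := by
      simp [Matrix.sub_mulVec]
    exact congrFun this i
  rw [hsub]
  calc |∑ j, (1 - M) i j * x j| ≤ ∑ j, |(1 - M) i j * x j| := Finset.abs_sum_le_sum_abs _ _
    _ ≤ ∑ j, B * |x j| := Finset.sum_le_sum fun j _ => by
        rw [abs_mul]
        exact mul_le_mul_of_nonneg_right (h i j) (abs_nonneg _)
    _ = B * ∑ j, |x j| := (Finset.mul_sum _ _ _).symm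
    _ ≤ B := mul_le_of_le_one_right hB hx1

/-- Two distinct polynomials of degree less than `k` agree at no more than `k` points. -/
lemma card_filter_eval_eq_le {F : Type*} [Field F] [Fintype F] [DecidableEq F] {k : ℕ}
    {f g : Polynomial F} (hf : f.degree < k) (hg : g.degree < k) (hfg : f ≠ g) :
    (Finset.univ.filter fun t => f.eval t = g.eval t).card ≤ k := by
  by_contra! h
  refine hfg (Polynomial.eq_of_degrees_lt_of_eval_finset_eq
    (Finset.univ.filter fun t => f.eval t = g.eval t) ?_ ?_ ?_)
  · exact hf.trans (by exact_mod_cast h)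
  · exact hg.trans (by exact_mod_cast h)
  · simp

/-- The Reed–Solomon construction: the Gram matrix of the normalized graph indicators of
polynomials over `ZMod q` is a low rank approximation of the identity. -/
lemma approxNumber_top_le_of_prime {p : ℝ} (hp : 0 < p) (hp1 : p ≤ 1) {N n q k : ℕ}
    (hq : q.Prime) (hN : N ≤ q ^ k) (hqn : q ^ 2 < n) :
    approxNumber (ENNReal.ofReal p) ∞ N n ≤ k / q := by
  have : Fact q.Prime := ⟨hq⟩
  have hq0 : (0 : ℝ) < q := by exact_mod_cast hq.pos
  obtain ⟨e⟩ : Nonempty (Fin N ↪ (Fin k → ZMod q)) :=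
    Function.Embedding.nonempty_of_card_le (by simpa using hN)
  let f : Fin N → Polynomial (ZMod q) := fun i =>
    ((Polynomial.degreeLTEquiv (ZMod q) k).symm (e i) : Polynomial (ZMod q))
  have hf : Function.Injective f := fun i j hij =>
    e.injective ((Polynomial.degreeLTEquiv (ZMod q) k).symm.injective (Subtype.ext hij))
  have hdeg : ∀ i, (f i).degree < k := fun i =>
    Polynomial.mem_degreeLT.mp ((Polynomial.degreeLTEquiv (ZMod q) k).symm (e i)).2
  let A : Matrix (Fin N) (ZMod q × ZMod q) ℝ := fun i z => if (f i).eval z.1 = z.2 then 1 else 0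
  have hG : ∀ i j, (((q : ℝ)⁻¹ • A) * A.transpose) i j =
      (q : ℝ)⁻¹ * (Finset.univ.filter fun t => (f i).eval t = (f j).eval t).card := by
    intro i j
    rw [Matrix.smul_mul, Matrix.smul_apply, smul_eq_mul, Matrix.mul_apply,
      Fintype.sum_prod_type, Finset.card_filter]
    push_cast
    congr 1
    refine Finset.sum_congr rfl fun t _ => ?_
    simp only [Matrix.transpose_apply]
    simp [A, eq_comm (a := (f j).eval t)]
  refine approxNumber_top_le_of_matrix hp hp1 (by positivity) (((q : ℝ)⁻¹ • A) * A.transpose)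
    ?_ fun i j => ?_
  · refine lt_of_le_of_lt ((Matrix.rank_mul_le_left _ _).trans (Matrix.rank_le_card_width _)) ?_
    simpa [ZMod.card, sq] using hqn
  · rw [Matrix.sub_apply, hG]
    rcases eq_or_ne i j with rfl | hij
    · have : (q : ℝ)⁻¹ * q = 1 := inv_mul_cancel₀ hq0.ne'
      simp only [Matrix.one_apply_eq, Finset.filter_true, Finset.card_univ, ZMod.card, this,
        sub_self, abs_zero]
      positivity
    · rw [Matrix.one_apply_ne hij, zero_sub, abs_neg, abs_of_nonneg (by positivity),
        inv_mul_eq_div]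
      gcongr
      exact card_filter_eval_eq_le (hdeg i) (hdeg j) (hf.ne hij)

lemma approxNumber_top_le_one {p : ℝ} (hp : 0 < p) (hp1 : p ≤ 1) {N n : ℕ} (hn : 1 ≤ n) :
    approxNumber (ENNReal.ofReal p) ∞ N n ≤ 1 := by
  refine approxNumber_top_le_of_matrix hp hp1 zero_le_one 0
    (by rw [Matrix.rank_zero]; exact hn) fun i j => ?_
  rw [sub_zero, Matrix.one_apply]
  split_ifs <;> simp

lemma approxNumber_top_le_zero {p : ℝ} (hp : 0 < p) (hp1 : p ≤ 1) {N n : ℕ} (hn : N < n) :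
    approxNumber (ENNReal.ofReal p) ∞ N n ≤ 0 :=
  approxNumber_top_le_of_matrix hp hp1 le_rfl 1 (by simpa using hn) fun i j => by simp

/-- Bertrand's postulate at the scale `√n`. -/
lemma exists_prime_sq_lt_le {n : ℕ} (hn : 5 ≤ n) :
    ∃ q : ℕ, q.Prime ∧ q ^ 2 < n ∧ n ≤ (2 * q) ^ 2 := by
  set r := Nat.sqrt (n - 1) with hr
  have h1 : r * r ≤ n - 1 := Nat.sqrt_le _
  have h2 : n - 1 < (r + 1) * (r + 1) := Nat.lt_succ_sqrt _
  have hr2 : 2 ≤ r := Nat.le_sqrt.mpr (by omega)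
  obtain ⟨q, hq, hq1, hq2⟩ := Nat.exists_prime_lt_and_le_two_mul (r / 2) (by omega)
  have hqr : q ≤ r := by omega
  have hrq : r + 1 ≤ 2 * q := by omega
  refine ⟨q, hq, ?_, ?_⟩
  · have := Nat.mul_le_mul hqr hqr
    rw [sq]
    omega
  · have := Nat.mul_le_mul hrq hrq
    rw [sq]
    omega

/-- For `0 < p₁ ≤ 1`, `0 < λ < 1` and `1/s > 1/(2(1-λ))` there is `C > 0` with
`sup_n n^{1/s}·a_n(id : ℓ_{p₁}^N → ℓ_∞^N) ≤ C·N^{1/s - 1/2}` for every `N`. -/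
theorem approx_ideal_norm_subcritical (p₁ lam s : ℝ) (h1 : 0 < p₁) (h2 : p₁ ≤ 1)
    (hl1 : 0 < lam) (hl2 : lam < 1) (hs : 0 < s) (hs2 : 1 / (2 * (1 - lam)) < 1/s) :
    ∃ C : ℝ, 0 < C ∧ ∀ N n : ℕ, 1 ≤ n →
      (n : ℝ) ^ (1/s) * approxNumber (ENNReal.ofReal p₁) ∞ N n ≤
        C * (N : ℝ) ^ (1/s - 1/2) := by
  set α := 1 / s with hα
  have hα0 : 0 < α := by positivity
  have hδ : 0 < α - 1 / 2 := by
    have : 1 / 2 ≤ 1 / (2 * (1 - lam)) :=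
      one_div_le_one_div_of_le (by linarith) (by linarith)
    linarith
  obtain ⟨k, hk⟩ := exists_nat_ge (4 * α / (α - 1 / 2))
  rw [div_le_iff₀ hδ] at hk
  have h16 : (0 : ℝ) < 16 ^ α := by positivity
  refine ⟨16 ^ α + (2 * k + 1), by positivity, fun N n hn => ?_⟩
  have hnR : (1 : ℝ) ≤ n := by exact_mod_cast hn
  have hn0 : (0 : ℝ) < n := by linarith
  have hnα : (0 : ℝ) ≤ (n : ℝ) ^ α := by positivity
  have hNδ : (0 : ℝ) ≤ (N : ℝ) ^ (α - 1 / 2) := by positivity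
  have hkR : (0 : ℝ) ≤ k := by positivity
  rcases lt_or_ge N n with hNn | hNn
  · exact (mul_nonpos_of_nonneg_of_nonpos hnα (approxNumber_top_le_zero h1 h2 hNn)).trans
      (by positivity)
  have hNnR : (n : ℝ) ≤ N := by exact_mod_cast hNn
  have hN1 : (1 : ℝ) ≤ (N : ℝ) ^ (α - 1 / 2) := Real.one_le_rpow (by linarith) hδ.le
  have htriv : (n : ℝ) ^ α * approxNumber (ENNReal.ofReal p₁) ∞ N n ≤ (n : ℝ) ^ α :=
    mul_le_of_le_one_right hnα (approxNumber_top_le_one h1 h2 hn)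
  rcases lt_or_ge n 16 with hn16 | hn16
  · have : (n : ℝ) ^ α ≤ 16 ^ α :=
      Real.rpow_le_rpow hn0.le (by exact_mod_cast hn16.le) hα0.le
    nlinarith
  obtain ⟨q, hq, hqn, hnq⟩ := exists_prime_sq_lt_le (show 5 ≤ n by omega)
  have hq0 : (0 : ℝ) < q := by exact_mod_cast hq.pos
  have hsqrt : (n : ℝ) ^ (1 / 2 : ℝ) ≤ 2 * q := by
    rw [← Real.sqrt_eq_rpow]
    exact Real.sqrt_le_iff.mpr ⟨by positivity, by exact_mod_cast hnq⟩
  rcases le_or_gt N (q ^ k) with hNq | hNq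
  · have hsplit : (n : ℝ) ^ α = (n : ℝ) ^ (α - 1 / 2) * (n : ℝ) ^ (1 / 2 : ℝ) := by
      rw [← Real.rpow_add hn0]
      congr 1
      ring
    have hnN : (n : ℝ) ^ (α - 1 / 2) ≤ (N : ℝ) ^ (α - 1 / 2) :=
      Real.rpow_le_rpow hn0.le hNnR hδ.le
    calc (n : ℝ) ^ α * approxNumber (ENNReal.ofReal p₁) ∞ N n ≤ (n : ℝ) ^ α * (k / q) :=
          mul_le_mul_of_nonneg_left (approxNumber_top_le_of_prime h1 h2 hq hNq hqn) hnα
      _ ≤ ((N : ℝ) ^ (α - 1 / 2) * (2 * q)) * (k / q) := by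
          rw [hsplit]
          gcongr
      _ = 2 * k * (N : ℝ) ^ (α - 1 / 2) := by
          field_simp
      _ ≤ (16 ^ α + (2 * k + 1)) * (N : ℝ) ^ (α - 1 / 2) := by
          gcongr
          linarith
  · have hq4 : (n : ℝ) ^ (1 / 4 : ℝ) ≤ q := by
      have hsq : (n : ℝ) ^ (1 / 2 : ℝ) = ((n : ℝ) ^ (1 / 4 : ℝ)) ^ 2 := by
        rw [← Real.rpow_natCast, ← Real.rpow_mul hn0.le]
        norm_num
      have h2 : (2 : ℝ) ≤ (n : ℝ) ^ (1 / 4 : ℝ) := by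
        calc (2 : ℝ) = ((2 : ℝ) ^ (4 : ℝ)) ^ (1 / 4 : ℝ) := by
              rw [← Real.rpow_mul (by norm_num)]
              norm_num
          _ ≤ (n : ℝ) ^ (1 / 4 : ℝ) := by
              refine Real.rpow_le_rpow (by positivity) ?_ (by norm_num)
              norm_num
              exact_mod_cast hn16
      nlinarith
    have hqN : (q : ℝ) ^ (k : ℝ) ≤ N := by
      rw [Real.rpow_natCast]
      exact_mod_cast hNq.le
    have hmain : (n : ℝ) ^ α ≤ (N : ℝ) ^ (α - 1 / 2) := by
      calc (n : ℝ) ^ α ≤ (n : ℝ) ^ (1 / 4 * (k * (α - 1 / 2))) :=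
            Real.rpow_le_rpow_of_exponent_le hnR (by linarith)
        _ = (((n : ℝ) ^ (1 / 4 : ℝ)) ^ (k : ℝ)) ^ (α - 1 / 2) := by
            rw [Real.rpow_mul hn0.le, Real.rpow_mul (by positivity)]
        _ ≤ ((q : ℝ) ^ (k : ℝ)) ^ (α - 1 / 2) := by gcongr
        _ ≤ (N : ℝ) ^ (α - 1 / 2) := by gcongr
    nlinarith
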